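/- Let u ∈ C^∞(ℝⁿ \ {0}) be a solution to the special Lagrangian equation ∑_{i=1}^n arctan λᵢ(x) = c on ℝⁿ \ {0} that is homogeneous of order 2, i.e. u(x) = |x|² u(x/|x|) for all x ≠ 0. Suppose that 3 + (1−ε)λᵢ(x)² + 2λᵢ(x)λⱼ(x) ≥ 0 for all indices i, j, all x ≠ 0, and some fixed ε > 0. Then u is quadratic: D²u is constant on ℝⁿ \ {0}, so u(x) = ½⟨Ax,x⟩ for a constant symmetric matrix A. -/

import Mathlib

noncomputable section

/-- The Hessian matrix `D²u(x)`, with entries `∂ᵢ∂ⱼ u (x)`. -/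
def Hess {n : ℕ} (u : EuclideanSpace ℝ (Fin n) → ℝ) (x : EuclideanSpace ℝ (Fin n)) :
    Matrix (Fin n) (Fin n) ℝ :=
  Matrix.of fun i j =>
    iteratedFDeriv ℝ 2 u x ![EuclideanSpace.single i 1, EuclideanSpace.single j 1]

/-- The induced metric `g = I + D²u · D²u` on the gradient graph `(x, ∇u(x))`. -/
def gMat {n : ℕ} (u : EuclideanSpace ℝ (Fin n) → ℝ) (x : EuclideanSpace ℝ (Fin n)) :
    Matrix (Fin n) (Fin n) ℝ :=
  1 + Hess u x * Hess u x

/-- The Laplace–Beltrami operator `Δ_g v = ∑ g^{ij} ∂ᵢ∂ⱼ v` of the induced metric. -/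
def lapg {n : ℕ} (u v : EuclideanSpace ℝ (Fin n) → ℝ) (x : EuclideanSpace ℝ (Fin n)) : ℝ :=
  ∑ i, ∑ j, (gMat u x)⁻¹ i j *
    iteratedFDeriv ℝ 2 v x ![EuclideanSpace.single i 1, EuclideanSpace.single j 1]

/-- The squared metric gradient norm `|∇_g v|²_g = ∑ g^{ij} ∂ᵢv ∂ⱼv`. -/
def gradSq {n : ℕ} (u v : EuclideanSpace ℝ (Fin n) → ℝ) (x : EuclideanSpace ℝ (Fin n)) : ℝ :=
  ∑ i, ∑ j, (gMat u x)⁻¹ i j * fderiv ℝ v x (EuclideanSpace.single i 1) *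
    fderiv ℝ v x (EuclideanSpace.single j 1)

/-- The volume element `V = √(det g)`. -/
def Vol {n : ℕ} (u : EuclideanSpace ℝ (Fin n) → ℝ) (x : EuclideanSpace ℝ (Fin n)) : ℝ :=
  Real.sqrt ((gMat u x).det)

end


lemma sl_det_hasDerivAt {n : ℕ} (M : ℝ → Matrix (Fin n) (Fin n) ℂ) (M1 : Matrix (Fin n) (Fin n) ℂ)
    (t : ℝ) (h : ∀ i j, HasDerivAt (fun s => M s i j) (M1 i j) t) :
    HasDerivAt (fun s => (M s).det) (((M t).adjugate * M1).trace) t := by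
  have h1 : HasDerivAt (fun s => ∑ σ : Equiv.Perm (Fin n),
      ((Equiv.Perm.sign σ : ℤ) : ℂ) * ∏ i, M s (σ i) i)
      (∑ σ : Equiv.Perm (Fin n), ((Equiv.Perm.sign σ : ℤ) : ℂ) *
        ∑ i, (∏ j ∈ Finset.univ.erase i, M t (σ j) j) • M1 (σ i) i) t := by
    apply HasDerivAt.fun_sum
    intro σ _
    apply HasDerivAt.const_mul
    apply HasDerivAt.fun_finsetProd
    intro i _
    exact h _ _
  simp only [Matrix.det_apply']
  refine h1.congr_deriv ?_
  symm
  have h2 : ((M t).adjugate * M1).trace =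
      ∑ i, ((M t).updateCol i (fun k => M1 k i)).det := by
    unfold Matrix.trace
    apply Finset.sum_congr rfl
    intro i _
    rw [← Matrix.cramer_apply, Matrix.cramer_eq_adjugate_mulVec]
    rfl
  rw [h2]
  simp only [Matrix.det_apply', Finset.mul_sum]
  rw [Finset.sum_comm]
  refine Finset.sum_congr rfl fun σ _ => Finset.sum_congr rfl fun i _ => ?_
  congr 1
  rw [← Finset.prod_erase_mul _ _ (Finset.mem_univ i)]
  simp only [Matrix.updateCol_self, smul_eq_mul]
  congr 1
  apply Finset.prod_congr rfl
  intro j hj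
  rw [Matrix.updateCol_ne (Finset.ne_of_mem_erase hj)]

lemma sl_det_second {n : ℕ} (M M1 : ℝ → Matrix (Fin n) (Fin n) ℂ) (M2 : Matrix (Fin n) (Fin n) ℂ)
    (d : Fin n → ℂ) (hd : ∀ i, d i ≠ 0) (hM0 : M 0 = Matrix.diagonal d)
    (hM : ∀ i j, HasDerivAt (fun s => M s i j) (M1 0 i j) 0)
    (hM1 : ∀ i j, HasDerivAt (fun s => M1 s i j) (M2 i j) 0) :
    ((M 0).adjugate * M1 0).trace = (M 0).det * ∑ j, M1 0 j j / d j ∧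
    HasDerivAt (fun s => ((M s).adjugate * M1 s).trace)
      ((M 0).det * ((∑ j, M1 0 j j / d j) ^ 2 + ∑ j, M2 j j / d j
        - ∑ i, ∑ j, M1 0 i j * M1 0 j i / (d i * d j))) 0 := by
  set P := (M 0).det with hP
  have hN0 : ∀ i j, (M 0).adjugate i j = if i = j then P / d j else 0 := by
    intro i j
    have := congrFun (congrFun (Matrix.adjugate_mul (M 0)) i) j
    nth_rewrite 2 [hM0] at this
    rw [Matrix.mul_diagonal] at this
    rw [eq_div_of_mul_eq (hd j) this]
    by_cases hij : i = j <;> simp [hij, hP]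
  have htr : ((M 0).adjugate * M1 0).trace = P * ∑ j, M1 0 j j / d j := by
    simp only [Matrix.trace, Matrix.diag, Matrix.mul_apply, hN0, ite_mul, zero_mul,
      Finset.sum_ite_eq, Finset.mem_univ, if_true, Finset.mul_sum]
    refine Finset.sum_congr rfl fun j _ => ?_
    ring
  refine ⟨htr, ?_⟩
  have hadj : ∀ i j, ∃ N1 : ℂ, HasDerivAt (fun s => (M s).adjugate i j) N1 0 := by
    intro i j
    simp only [Matrix.adjugate_apply]
    refine ⟨_, sl_det_hasDerivAt (fun s => (M s).updateRow j (Pi.single i 1))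
      ((M1 0).updateRow j 0) 0 ?_⟩
    intro k l
    by_cases hk : k = j
    · subst hk
      simp only [Matrix.updateRow_self]
      exact hasDerivAt_const _ _
    · simp only [Matrix.updateRow_ne hk]
      exact hM k l
  choose N1 hN1 using hadj
  have hdet := sl_det_hasDerivAt M (M1 0) 0 hM
  rw [htr] at hdet
  have hN1v : ∀ i j, N1 i j = ((if i = j then P * ∑ j, M1 0 j j / d j else 0)
      - P / d i * M1 0 i j) / d j := by
    intro i j
    have e1 : HasDerivAt (fun s => ∑ k, (M s).adjugate i k * M s k j)
        (∑ k, (N1 i k * M 0 k j + (M 0).adjugate i k * M1 0 k j)) 0 :=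
      HasDerivAt.fun_sum fun k _ => (hN1 i k).mul (hM k j)
    have e2 : HasDerivAt (fun s => ∑ k, (M s).adjugate i k * M s k j)
        (if i = j then P * ∑ j, M1 0 j j / d j else 0) 0 := by
      have : (fun s => ∑ k, (M s).adjugate i k * M s k j) =
          fun s => if i = j then (M s).det else 0 := by
        funext s
        have := congrFun (congrFun (Matrix.adjugate_mul (M s)) i) j
        rw [Matrix.mul_apply] at this
        rw [this]
        by_cases hij : i = j <;> simp [hij]
      rw [this]
      by_cases hij : i = j
      · simpa only [hij, if_true] using hdet
      · simpa only [hij, if_false] using hasDerivAt_const _ _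
    have e3 := e1.unique e2
    rw [← e3, Finset.sum_add_distrib]
    simp only [hN0, ite_mul, zero_mul, Finset.sum_ite_eq, Finset.mem_univ, if_true]
    simp only [hM0, Matrix.diagonal_apply, mul_ite, mul_zero, Finset.sum_ite_eq', Finset.mem_univ, if_true]
    rw [add_sub_cancel_right, mul_div_cancel_right₀ _ (hd j)]
  have e1 : HasDerivAt (fun s => ∑ i, ∑ k, (M s).adjugate i k * M1 s k i)
        (∑ i, ∑ k, (N1 i k * M1 0 k i + (M 0).adjugate i k * M2 k i)) 0 :=
      by
    apply HasDerivAt.fun_sum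
    intro i _
    apply HasDerivAt.fun_sum
    intro k _
    exact (hN1 i k).mul (hM1 k i)
  have e2 : (fun s => ((M s).adjugate * M1 s).trace) =
      (fun s => ∑ i, ∑ k, (M s).adjugate i k * M1 s k i) := by
    funext s
    simp only [Matrix.trace, Matrix.diag, Matrix.mul_apply]
  rw [e2]
  refine e1.congr_deriv ?_
  simp only [Finset.sum_add_distrib, hN0, hN1v, ite_mul, zero_mul, Finset.sum_ite_eq,
    Finset.mem_univ, if_true, sub_div, sub_mul, ite_div, zero_div, Finset.sum_sub_distrib]
  set Q := ∑ j, M1 0 j j / d j with hQ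
  have f1 : ∑ i, P * Q / d i * M1 0 i i = P * Q ^ 2 := by
    have : P * Q ^ 2 = ∑ j, P * Q * (M1 0 j j / d j) := by
      rw [← Finset.mul_sum, ← hQ]; ring
    rw [this]
    refine Finset.sum_congr rfl fun j _ => ?_
    ring
  have f2 : ∑ i, P / d i * M2 i i = P * ∑ j, M2 j j / d j := by
    rw [Finset.mul_sum]
    refine Finset.sum_congr rfl fun j _ => ?_
    ring
  have f3 : ∑ x, ∑ x_1, P / d x * M1 0 x x_1 / d x_1 * M1 0 x_1 x =
      P * ∑ i, ∑ j, M1 0 i j * M1 0 j i / (d i * d j) := by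
    simp only [Finset.mul_sum]
    refine Finset.sum_congr rfl fun i _ => Finset.sum_congr rfl fun j _ => ?_
    field_simp
  rw [f1, f2, f3]
  ring

lemma sl_triple_aux (a b c : ℝ) (hb : 0 ≤ b) (hab : b ≤ a) (hc : 0 ≤ c)
    (h1 : 0 < 3 + a ^ 2 - 2 * a * c) (h2 : 0 < 3 + c ^ 2 - 2 * a * c) :
    0 < 3 + a * b - c * (a + b) := by
  rcases le_or_gt c a with h | h
  · have : c * c ≤ a * c := mul_le_mul_of_nonneg_right h hc
    nlinarith [mul_nonneg hb (sub_nonneg.2 h)]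
  · nlinarith [mul_nonneg (sub_nonneg.2 hab) (sub_nonneg.2 h.le)]

lemma sl_triple_aux2 (a b c : ℝ) (ha : 0 ≤ a) (hb : 0 ≤ b) (hc : 0 ≤ c)
    (h1 : 0 < 3 + a ^ 2 - 2 * a * c) (h2 : 0 < 3 + c ^ 2 - 2 * a * c)
    (h3 : 0 < 3 + b ^ 2 - 2 * b * c) (h4 : 0 < 3 + c ^ 2 - 2 * b * c) :
    0 < 3 + a * b - c * (a + b) := by
  rcases le_total b a with h | h
  · exact sl_triple_aux a b c hb h hc h1 h2
  · have := sl_triple_aux b a c ha h hc h3 h4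
    linarith

lemma sl_triple (a b c : ℝ) (hab : 0 < 3 + a ^ 2 + 2 * a * b) (hba : 0 < 3 + b ^ 2 + 2 * b * a)
    (hac : 0 < 3 + a ^ 2 + 2 * a * c) (hca : 0 < 3 + c ^ 2 + 2 * c * a)
    (hbc : 0 < 3 + b ^ 2 + 2 * b * c) (hcb : 0 < 3 + c ^ 2 + 2 * c * b) :
    0 < 3 + a * b + b * c + c * a := by
  rcases le_total 0 a with ha | ha <;> rcases le_total 0 b with hb | hb <;>
    rcases le_total 0 c with hc | hc
  · positivity
  · have := sl_triple_aux2 a b (-c) ha hb (by linarith) (by linarith) (by linarith)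
      (by linarith) (by linarith)
    linarith
  · have := sl_triple_aux2 a c (-b) ha hc (by linarith) (by linarith) (by linarith)
      (by linarith) (by linarith)
    linarith
  · have := sl_triple_aux2 (-b) (-c) a (by linarith) (by linarith) ha (by linarith) (by linarith)
      (by linarith) (by linarith)
    linarith
  · have := sl_triple_aux2 b c (-a) hb hc (by linarith) (by linarith) (by linarith)
      (by linarith) (by linarith)
    linarith
  · have := sl_triple_aux2 (-a) (-c) b (by linarith) (by linarith) hb (by linarith) (by linarith)
      (by linarith) (by linarith)
    linarith
  · have := sl_triple_aux2 (-a) (-b) c (by linarith) (by linarith) hc (by linarith) (by linarith)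
      (by linarith) (by linarith)
    linarith
  · have := mul_nonneg_of_nonpos_of_nonpos ha hb
    have := mul_nonneg_of_nonpos_of_nonpos hb hc
    have := mul_nonneg_of_nonpos_of_nonpos hc ha
    linarith

/-- The algebraic core: from the real and imaginary parts of the second derivative of
`det (1 + i H)` in all eigen-directions. -/
lemma sl_core {n : ℕ} (l : Fin n → ℝ) (T : Fin n → Fin n → Fin n → ℝ) (U : Fin n → Fin n → ℝ)
    (hU : ∀ i j, U i j = U j i) (hT1 : ∀ i j k, T i j k = T j i k) (hT2 : ∀ i j k, T i j k = T i k j)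
    (hl : ∀ i j, 0 < 3 + l i ^ 2 + 2 * l i * l j)
    (g : Fin n → ℝ) (hg : ∀ i, 0 < g i)
    (him : ∀ k, ∑ j, g j * U k j = ∑ i, ∑ j, g i * g j * (l i + l j) * T k i j ^ 2)
    (a : Fin n → ℝ) (r : Fin n → ℝ)
    (hr : ∀ k, r k = a k ^ 2 + ∑ j, g j * l j * U k j
      + ∑ i, ∑ j, g i * g j * (1 - l i * l j) * T k i j ^ 2) :
    0 ≤ ∑ k, g k * r k ∧ (∑ k, g k * r k = 0 → ∀ i j k, T i j k = 0) := by
  set w : Fin n → Fin n → Fin n → ℝ := fun i j k => g i * g j * g k * T i j k ^ 2 with hw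
  have w1 : ∀ i j k, w i j k = w j i k := by
    intro i j k; simp only [hw]; rw [hT1 i j k]; ring
  have w2 : ∀ i j k, w i j k = w i k j := by
    intro i j k; simp only [hw]; rw [hT2 i j k]; ring
  have hw0 : ∀ i j k, 0 ≤ w i j k := fun i j k =>
    mul_nonneg (mul_nonneg (mul_nonneg (hg i).le (hg j).le) (hg k).le) (sq_nonneg _)
  have key1 : ∑ k, ∑ j, g k * (g j * l j * U k j)
      = ∑ k, ∑ i, ∑ j, (l k * l i + l k * l j) * w k i j := by
    rw [Finset.sum_comm]
    refine Finset.sum_congr rfl fun k _ => ?_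
    have : ∑ x, g x * (g k * l k * U x k) = g k * l k * ∑ j, g j * U k j := by
      rw [Finset.mul_sum]
      refine Finset.sum_congr rfl fun j _ => ?_
      rw [hU j k]; ring
    rw [this, him, Finset.mul_sum]
    refine Finset.sum_congr rfl fun i _ => ?_
    rw [Finset.mul_sum]
    refine Finset.sum_congr rfl fun j _ => ?_
    simp only [hw]; ring
  have p1 : ∑ k, ∑ i, ∑ j, l k * l i * w k i j = ∑ k, ∑ i, ∑ j, l k * l j * w k i j := by
    refine Finset.sum_congr rfl fun k _ => ?_
    rw [Finset.sum_comm]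
    refine Finset.sum_congr rfl fun i _ => Finset.sum_congr rfl fun j _ => ?_
    rw [w2]
  have p2 : ∑ k, ∑ i, ∑ j, l i * l j * w k i j = ∑ k, ∑ i, ∑ j, l k * l j * w k i j := by
    rw [Finset.sum_comm]
    refine Finset.sum_congr rfl fun k _ => ?_
    refine Finset.sum_congr rfl fun i _ => Finset.sum_congr rfl fun j _ => ?_
    rw [w1]
  have tot : ∑ k, g k * r k = ∑ k, g k * a k ^ 2 +
      ∑ k, ∑ i, ∑ j, (1 / 3) * ((3 + l k * l i + l i * l j + l j * l k) * w k i j) := by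
    have e1 : ∑ k, g k * r k = ∑ k, g k * a k ^ 2 + ∑ k, ∑ j, g k * (g j * l j * U k j)
        + ∑ k, ∑ i, ∑ j, (1 - l i * l j) * w k i j := by
      rw [← Finset.sum_add_distrib, ← Finset.sum_add_distrib]
      refine Finset.sum_congr rfl fun k _ => ?_
      rw [hr, mul_add, mul_add, Finset.mul_sum, Finset.mul_sum]
      congr 1
      refine Finset.sum_congr rfl fun i _ => ?_
      rw [Finset.mul_sum]
      refine Finset.sum_congr rfl fun j _ => ?_
      simp only [hw]; ring
    have e2 : ∑ k, ∑ i, ∑ j, (1 / 3) * ((3 + l k * l i + l i * l j + l j * l k) * w k i j)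
        = ∑ k, ∑ i, ∑ j, w k i j + (1/3) * ∑ k, ∑ i, ∑ j, l k * l i * w k i j
        + (1/3) * ∑ k, ∑ i, ∑ j, l i * l j * w k i j
        + (1/3) * ∑ k, ∑ i, ∑ j, l k * l j * w k i j := by
      simp only [Finset.mul_sum, ← Finset.sum_add_distrib]
      refine Finset.sum_congr rfl fun k _ => Finset.sum_congr rfl fun i _ =>
        Finset.sum_congr rfl fun j _ => ?_
      ring
    rw [e1, e2, key1]
    simp only [add_mul, sub_mul, one_mul, Finset.sum_add_distrib, Finset.sum_sub_distrib]
    rw [p1, p2]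
    ring
  have hs : ∀ i j k, 0 < 3 + l k * l i + l i * l j + l j * l k := fun i j k =>
    sl_triple _ _ _ (hl _ _) (hl _ _) (hl _ _) (hl _ _) (hl _ _) (hl _ _)
  have t1 : 0 ≤ ∑ k, g k * a k ^ 2 :=
    Finset.sum_nonneg fun k _ => mul_nonneg (hg k).le (sq_nonneg _)
  have t0 : ∀ k i j, 0 ≤ (1 / 3) * ((3 + l k * l i + l i * l j + l j * l k) * w k i j) :=
    fun k i j => mul_nonneg (by norm_num) (mul_nonneg (hs i j k).le (hw0 k i j))
  have t2 : 0 ≤ ∑ k, ∑ i, ∑ j, (1 / 3) * ((3 + l k * l i + l i * l j + l j * l k) * w k i j) :=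
    Finset.sum_nonneg fun k _ => Finset.sum_nonneg fun i _ => Finset.sum_nonneg fun j _ => t0 k i j
  refine ⟨by rw [tot]; linarith, fun h0 i j k => ?_⟩
  have t3 : ∑ k, ∑ i, ∑ j, (1 / 3) * ((3 + l k * l i + l i * l j + l j * l k) * w k i j) = 0 := by
    rw [tot] at h0; linarith
  rw [Finset.sum_eq_zero_iff_of_nonneg (fun k _ => Finset.sum_nonneg fun i _ =>
    Finset.sum_nonneg fun j _ => t0 k i j)] at t3
  have t4 := t3 i (Finset.mem_univ _)
  rw [Finset.sum_eq_zero_iff_of_nonneg (fun i _ => Finset.sum_nonneg fun j _ => t0 _ i j)] at t4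
  have t5 := t4 j (Finset.mem_univ _)
  rw [Finset.sum_eq_zero_iff_of_nonneg (fun j _ => t0 _ _ j)] at t5
  have t6 := t5 k (Finset.mem_univ _)
  have hsk := hs j k i
  have : w i j k = 0 := by
    rcases mul_eq_zero.1 t6 with h | h
    · norm_num at h
    · exact (mul_eq_zero.1 h).resolve_left hsk.ne'
  simp only [hw] at this
  have hne : g i * g j * g k ≠ 0 :=
    mul_ne_zero (mul_ne_zero (hg i).ne' (hg j).ne') (hg k).ne'
  exact pow_eq_zero_iff (two_ne_zero) |>.1 ((mul_eq_zero.1 this).resolve_left hne)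

lemma sl_second_test (f f1 : ℝ → ℝ) (f2 : ℝ) (hf : ∀ᶠ t in nhds 0, HasDerivAt f (f1 t) t)
    (hf1 : HasDerivAt f1 f2 0) (hmax : IsLocalMax f 0) : f2 ≤ 0 := by
  by_contra hpos
  push Not at hpos
  have hd : deriv f =ᶠ[nhds 0] f1 := hf.mono fun t ht => ht.deriv
  have hdd : deriv (deriv f) 0 = f2 := by
    rw [hd.deriv_eq, hf1.deriv]
  have hmin : IsLocalMin f 0 := isLocalMin_of_deriv_deriv_pos (by rw [hdd]; exact hpos)
    hmax.deriv_eq_zero hf.self_of_nhds.continuousAt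
  have hc : f =ᶠ[nhds 0] fun _ => f 0 := by
    filter_upwards [hmax, hmin] with t h1 h2
    exact le_antisymm h1 h2
  have h3 : deriv f =ᶠ[nhds 0] fun _ => 0 := by
    filter_upwards [hc.deriv] with t ht
    simpa using ht
  have h4 := h3.deriv_eq
  rw [hdd] at h4
  simp at h4
  linarith

lemma sl_barrier_deriv {E : Type*} [NormedAddCommGroup E] [InnerProductSpace ℝ E]
    (α : ℝ) (x y b : E) (hb : ‖b‖ = 1) :
    (∀ t : ℝ, HasDerivAt (fun t : ℝ => Real.exp (-α * ‖x + t • b - y‖ ^ 2))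
      (Real.exp (-α * ‖x + t • b - y‖ ^ 2) * (-α * (2 * inner ℝ (x - y) b + 2 * t))) t) ∧
    HasDerivAt (fun t : ℝ => Real.exp (-α * ‖x + t • b - y‖ ^ 2) *
      (-α * (2 * inner ℝ (x - y) b + 2 * t)))
      (Real.exp (-α * ‖x - y‖ ^ 2) * (4 * α ^ 2 * (inner ℝ (x - y) b) ^ 2 - 2 * α)) 0 := by
  have e : ∀ t : ℝ, ‖x + t • b - y‖ ^ 2 = ‖x - y‖ ^ 2 + 2 * t * inner ℝ (x - y) b + t ^ 2 := by
    intro t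
    have : x + t • b - y = (x - y) + t • b := by abel
    rw [this, norm_add_sq_real, inner_smul_right, norm_smul, hb]
    simp
    ring
  have h1 : ∀ t : ℝ, HasDerivAt (fun t : ℝ => Real.exp (-α * ‖x + t • b - y‖ ^ 2))
      (Real.exp (-α * ‖x + t • b - y‖ ^ 2) * (-α * (2 * inner ℝ (x - y) b + 2 * t))) t := by
    intro t
    apply HasDerivAt.exp
    apply HasDerivAt.const_mul
    simp only [e]
    have := ((((hasDerivAt_id t).const_mul 2).mul_const (inner ℝ (x - y) b)).const_add
      (‖x - y‖ ^ 2)).add ((hasDerivAt_id t).pow 2)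
    exact this.congr_deriv (by simp)
  refine ⟨h1, ?_⟩
  have h2 : HasDerivAt (fun t : ℝ => (-α * (2 * inner ℝ (x - y) b + 2 * t))) (-α * 2) 0 := by
    apply HasDerivAt.const_mul
    simpa using ((hasDerivAt_id (0:ℝ)).const_mul 2).const_add (2 * inner ℝ (x - y) b)
  refine ((h1 0).mul h2).congr_deriv ?_
  simp
  ring

/-- Strong maximum principle in the punctured space. -/
lemma sl_smp {n : ℕ} (hn : 2 ≤ n) (V : EuclideanSpace ℝ (Fin n) → ℝ) (M m : ℝ) (hm : 0 < m)
    (hcont : ContinuousOn V {(0 : EuclideanSpace ℝ (Fin n))}ᶜ)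
    (hle : ∀ x, x ≠ 0 → V x ≤ M) (hex : ∃ x, x ≠ 0 ∧ V x = M)
    (hL : ∀ x : EuclideanSpace ℝ (Fin n), x ≠ 0 →
      ∃ (b : OrthonormalBasis (Fin n) ℝ (EuclideanSpace ℝ (Fin n)))
      (g : Fin n → ℝ) (f1 : Fin n → ℝ → ℝ) (f2 : Fin n → ℝ),
      (∀ k, m ≤ g k ∧ g k ≤ 1) ∧
      (∀ k, ∀ᶠ t in nhds (0 : ℝ), HasDerivAt (fun t : ℝ => V (x + t • b k)) (f1 k t) t) ∧
      (∀ k, HasDerivAt (f1 k) (f2 k) 0) ∧ 0 ≤ ∑ k, g k * f2 k) :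
    ∀ x, x ≠ 0 → V x = M := by
  have hconn : IsPreconnected ({(0 : EuclideanSpace ℝ (Fin n))}ᶜ : Set (EuclideanSpace ℝ (Fin n))) := by
    apply IsConnected.isPreconnected
    apply isConnected_compl_singleton_of_one_lt_rank
    rw [← Module.finrank_eq_rank]
    simp only [finrank_euclideanSpace, Fintype.card_fin]
    exact_mod_cast hn
  have hopen0 : IsOpen ({(0 : EuclideanSpace ℝ (Fin n))}ᶜ : Set (EuclideanSpace ℝ (Fin n))) := isOpen_compl_singleton
  set S : Set (EuclideanSpace ℝ (Fin n)) := {x | x ≠ 0 ∧ V x = M} with hS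
  have hSopen : IsOpen S := by
    rw [isOpen_iff_mem_nhds]
    rintro p ⟨hp0, hpM⟩
    by_contra hnot
    obtain ⟨r, hr, hrsub⟩ := Metric.isOpen_iff.1 hopen0 p hp0
    have hy : ∃ y ∈ Metric.ball p (r / 4), y ∉ S := by
      by_contra hcon
      push Not at hcon
      exact hnot (Filter.mem_of_superset (Metric.ball_mem_nhds p (by positivity)) hcon)
    obtain ⟨y, hyp, hyS⟩ := hy
    rw [Metric.mem_ball] at hyp
    set K : Set (EuclideanSpace ℝ (Fin n)) := Metric.closedBall p (r / 2) ∩ S with hK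
    have hballne : ∀ z, dist z p < r → z ≠ 0 := fun z hz => hrsub (Metric.mem_ball.2 hz)
    have hKclosed : IsClosed K := by
      have : K = Metric.closedBall p (r / 2) ∩ V ⁻¹' {M} := by
        ext z
        simp only [hK, hS, Set.mem_inter_iff, Metric.mem_closedBall, Set.mem_ofPred_eq,
          Set.mem_preimage, Set.mem_singleton_iff]
        constructor
        · rintro ⟨h1, h2, h3⟩; exact ⟨h1, h3⟩
        · rintro ⟨h1, h3⟩; exact ⟨h1, hballne z (by linarith), h3⟩
      rw [this]
      apply ContinuousOn.preimage_isClosed_of_isClosed _ Metric.isClosed_closedBall isClosed_singleton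
      apply hcont.mono
      intro z hz
      exact hballne z (by have := Metric.mem_closedBall.1 hz; linarith)
    obtain ⟨x0, hx0K, hx0⟩ := hKclosed.exists_infDist_eq_dist
      ⟨p, Metric.mem_closedBall_self (by positivity), hp0, hpM⟩ y
    have hmin : ∀ z ∈ K, dist y x0 ≤ dist y z := fun z hz => by
      rw [← hx0]; exact Metric.infDist_le_dist_of_mem hz
    set R := dist y x0 with hR
    have hRle : R < r / 4 := by
      have := hmin p ⟨Metric.mem_closedBall_self (by positivity), hp0, hpM⟩
      rw [dist_comm] at hyp; rw [dist_comm p y] at hyp; linarith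
    have hRpos : 0 < R := by
      rw [hR, dist_pos]; rintro rfl; exact hyS hx0K.2
    have hx00 : x0 ≠ 0 := hx0K.2.1
    have hx0M : V x0 = M := hx0K.2.2
    -- midpoint
    set y' : EuclideanSpace ℝ (Fin n) := (1 / 2 : ℝ) • (y + x0) with hy'
    have hpar : ∀ z : EuclideanSpace ℝ (Fin n), 4 * ‖z - y'‖ ^ 2 = 2 * ‖z - y‖ ^ 2 + 2 * ‖z - x0‖ ^ 2 - R ^ 2 := by
      intro z
      have h1 := parallelogram_law_with_norm ℝ (z - y) (z - x0)
      have h2 : z - y + (z - x0) = (2 : ℝ) • (z - y') := by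
        rw [hy', smul_sub, smul_smul, two_smul]; norm_num; abel
      have h3 : ‖z - y - (z - x0)‖ = R := by
        rw [hR, dist_comm, dist_eq_norm]; congr 1; abel
      rw [h2, h3, norm_smul] at h1
      norm_num at h1
      nlinarith [h1]
    have hx0y' : 4 * ‖x0 - y'‖ ^ 2 = R ^ 2 := by
      rw [hpar, ← dist_eq_norm x0 y, dist_comm x0 y, ← hR]; simp; ring
    have hx0y'' : ‖x0 - y'‖ = R / 2 := by
      have : ‖x0 - y'‖ ^ 2 = (R / 2) ^ 2 := by linarith
      exact (pow_left_inj₀ (norm_nonneg _) (by positivity) two_ne_zero).1 this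
    set ρ := R / 4 with hρ
    have hx0p : dist x0 p < r / 2 := by
      have := dist_triangle x0 y p
      rw [dist_comm x0 y] at this; linarith
    have hBne : ∀ z ∈ Metric.closedBall x0 ρ, z ≠ 0 := by
      intro z hz
      have h1 := Metric.mem_closedBall.1 hz
      have := dist_triangle z x0 p
      exact hballne z (by linarith)
    have hlt : ∀ z ∈ Metric.closedBall x0 ρ, ‖z - y'‖ ≤ R / 2 → z ≠ x0 → V z < M := by
      intro z hz hzy hzx
      refine lt_of_le_of_ne (hle z (hBne z hz)) fun hVz => ?_
      have h1 := Metric.mem_closedBall.1 hz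
      have hzy2 : ‖z - y'‖ ^ 2 ≤ (R / 2) ^ 2 := pow_le_pow_left₀ (norm_nonneg _) hzy 2
      have hpz := hpar z
      have hpos : 0 < ‖z - x0‖ ^ 2 := by
        have : 0 < ‖z - x0‖ := norm_pos_iff.2 (sub_ne_zero.2 hzx)
        positivity
      have hlt2 : ‖z - y‖ ^ 2 < R ^ 2 := by nlinarith
      have hlt3 : ‖z - y‖ < R := lt_of_pow_lt_pow_left₀ 2 hRpos.le hlt2
      have hzK : z ∈ K := by
        refine ⟨?_, hBne z hz, hVz⟩
        rw [Metric.mem_closedBall]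
        have := dist_triangle z y p
        rw [dist_eq_norm z y] at this
        linarith
      have := hmin z hzK
      rw [dist_comm, dist_eq_norm] at this
      linarith
    -- barrier
    obtain ⟨α, hα0, hα⟩ : ∃ α : ℝ, 0 < α ∧ (n : ℝ) < 2 * α * m * ρ ^ 2 := by
      have hmp : 0 < 2 * m * ρ ^ 2 := by positivity
      refine ⟨(n + 1) / (2 * m * ρ ^ 2), by positivity, ?_⟩
      have : 2 * ((n + 1) / (2 * m * ρ ^ 2)) * m * ρ ^ 2 = n + 1 := by
        have hρ0 : ρ ≠ 0 := by positivity
        field_simp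
      rw [this]; linarith
    set w : EuclideanSpace ℝ (Fin n) → ℝ := fun z => Real.exp (-α * ‖z - y'‖ ^ 2) - Real.exp (-α * (R / 2) ^ 2) with hw
    have hwc : Continuous w := by fun_prop
    have hwle : ∀ z, w z ≤ 1 := by
      intro z
      have h1 : Real.exp (-α * ‖z - y'‖ ^ 2) ≤ 1 := by
        rw [Real.exp_le_one_iff]
        have : 0 ≤ α * ‖z - y'‖ ^ 2 := by positivity
        linarith
      have h2 := Real.exp_pos (-α * (R / 2) ^ 2)
      simp only [hw]; linarith
    obtain ⟨δ, hδ, hδlt⟩ : ∃ δ : ℝ, 0 < δ ∧ ∀ z ∈ Metric.sphere x0 ρ, ‖z - y'‖ ≤ R / 2 →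
        V z + δ < M := by
      set C : Set (EuclideanSpace ℝ (Fin n)) := Metric.sphere x0 ρ ∩ Metric.closedBall y' (R / 2) with hC
      have hCc : IsCompact C := (isCompact_sphere x0 ρ).inter_right Metric.isClosed_closedBall
      rcases C.eq_empty_or_nonempty with hCe | hCne
      · refine ⟨1, one_pos, fun z hz hzy => ?_⟩
        have : z ∈ C := ⟨hz, by rw [Metric.mem_closedBall, dist_eq_norm]; exact hzy⟩
        rw [hCe] at this; exact this.elim
      · obtain ⟨q, hq, hqmax⟩ := hCc.exists_isMaxOn hCne (hcont.mono (fun z hz =>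
          hBne z (Metric.sphere_subset_closedBall hz.1)))
        have hqlt : V q < M := by
          apply hlt q (Metric.sphere_subset_closedBall hq.1)
          · have := Metric.mem_closedBall.1 hq.2
            rwa [dist_eq_norm] at this
          · rintro rfl
            have := Metric.mem_sphere.1 hq.1
            rw [dist_self] at this; linarith
        refine ⟨(M - V q) / 2, by linarith, fun z hz hzy => ?_⟩
        have : V z ≤ V q := hqmax (⟨hz, by rw [Metric.mem_closedBall, dist_eq_norm]; exact hzy⟩ : z ∈ C)
        linarith
    set F : EuclideanSpace ℝ (Fin n) → ℝ := fun z => V z + δ * w z with hF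
    have hFc : ContinuousOn F (Metric.closedBall x0 ρ) :=
      (hcont.mono fun z hz => hBne z hz).add (continuousOn_const.mul hwc.continuousOn)
    have hρpos : 0 < ρ := by positivity
    obtain ⟨z, hz, hzmax⟩ := (isCompact_closedBall x0 ρ).exists_isMaxOn
      ⟨x0, Metric.mem_closedBall_self hρpos.le⟩ hFc
    have hFx0 : F x0 = M := by
      simp only [hF, hw, hx0M, hx0y'']; ring
    have hFz : M ≤ F z := by
      rw [← hFx0]; exact hzmax (Metric.mem_closedBall_self hρpos.le)
    have hzball : z ∈ Metric.ball x0 ρ := by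
      rw [Metric.mem_ball]
      refine lt_of_le_of_ne (Metric.mem_closedBall.1 hz) fun heq => ?_
      rcases le_or_gt ‖z - y'‖ (R / 2) with h | h
      · have h1 := hδlt z heq h
        have h2 := mul_le_mul_of_nonneg_left (hwle z) hδ.le
        simp only [hF] at hFz; linarith
      · have h1 : w z < 0 := by
          simp only [hw]
          rw [sub_neg, Real.exp_lt_exp]
          have : (R / 2) ^ 2 < ‖z - y'‖ ^ 2 := pow_lt_pow_left₀ h (by positivity) two_ne_zero
          nlinarith
        have h2 := hle z (hBne z hz)
        have h3 := mul_neg_of_pos_of_neg hδ h1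
        simp only [hF] at hFz; linarith
    have hlocmax : IsLocalMax F z :=
      hzmax.isLocalMax (Filter.mem_of_superset (Metric.isOpen_ball.mem_nhds hzball)
        Metric.ball_subset_closedBall)
    have hzy' : ρ ≤ ‖z - y'‖ := by
      have h1 := norm_sub_norm_le (x0 - y') (x0 - z)
      have h2 : x0 - y' - (x0 - z) = z - y' := by abel
      have h3 := Metric.mem_closedBall.1 hz
      rw [dist_comm, dist_eq_norm] at h3
      rw [h2, hx0y''] at h1
      linarith
    obtain ⟨b, g, f1, f2, hg, hf1, hf2, hsum⟩ := hL z (hBne z hz)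
    have hk : ∀ k, f2 k + δ * (Real.exp (-α * ‖z - y'‖ ^ 2) *
        (4 * α ^ 2 * (inner ℝ (z - y') (b k)) ^ 2 - 2 * α)) ≤ 0 := by
      intro k
      obtain ⟨hb1, hb2⟩ := sl_barrier_deriv α z y' (b k) (b.orthonormal.1 k)
      refine sl_second_test (fun t : ℝ => F (z + t • b k)) _ _ ?_
        ((hf2 k).add (hb2.const_mul δ)) ?_
      · filter_upwards [hf1 k] with t ht
        exact ht.add (((hb1 t).sub_const _).const_mul δ)
      · have hc : Filter.Tendsto (fun t : ℝ => z + t • b k) (nhds 0) (nhds z) := by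
          have : Continuous (fun t : ℝ => z + t • b k) := by fun_prop
          simpa using this.tendsto 0
        have := hc.eventually hlocmax
        unfold IsLocalMax IsMaxFilter
        simpa using this
    have hsum2 : ∑ k, g k * (f2 k + δ * (Real.exp (-α * ‖z - y'‖ ^ 2) *
        (4 * α ^ 2 * (inner ℝ (z - y') (b k)) ^ 2 - 2 * α))) ≤ 0 :=
      Finset.sum_nonpos fun k _ => mul_nonpos_of_nonneg_of_nonpos (hm.le.trans (hg k).1) (hk k)
    have hsplit : ∑ k, g k * (f2 k + δ * (Real.exp (-α * ‖z - y'‖ ^ 2) *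
        (4 * α ^ 2 * (inner ℝ (z - y') (b k)) ^ 2 - 2 * α))) = ∑ k, g k * f2 k +
        δ * Real.exp (-α * ‖z - y'‖ ^ 2) * ∑ k, g k * (4 * α ^ 2 * (inner ℝ (z - y') (b k)) ^ 2 - 2 * α) := by
      rw [Finset.mul_sum, ← Finset.sum_add_distrib]
      refine Finset.sum_congr rfl fun k _ => ?_
      ring
    have hlow : ∑ k, (m * (4 * α ^ 2 * (inner ℝ (z - y') (b k)) ^ 2) - 2 * α) ≤
        ∑ k, g k * (4 * α ^ 2 * (inner ℝ (z - y') (b k)) ^ 2 - 2 * α) := by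
      refine Finset.sum_le_sum fun k _ => ?_
      have h1 : 0 ≤ 4 * α ^ 2 * (inner ℝ (z - y') (b k)) ^ 2 := by positivity
      nlinarith [mul_le_mul_of_nonneg_right (hg k).1 h1,
        mul_le_mul_of_nonneg_right (hg k).2 hα0.le]
    have hval : ∑ k, (m * (4 * α ^ 2 * (inner ℝ (z - y') (b k)) ^ 2) - 2 * α) =
        2 * α * (2 * α * m * ‖z - y'‖ ^ 2 - n) := by
      rw [Finset.sum_sub_distrib, ← Finset.mul_sum, ← Finset.mul_sum, b.sum_sq_inner_left]
      simp
      ring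
    have hpos : 0 < 2 * α * (2 * α * m * ‖z - y'‖ ^ 2 - n) := by
      have h1 : ρ ^ 2 ≤ ‖z - y'‖ ^ 2 := pow_le_pow_left₀ hρpos.le hzy' 2
      have h2 : 2 * α * m * ρ ^ 2 ≤ 2 * α * m * ‖z - y'‖ ^ 2 :=
        mul_le_mul_of_nonneg_left h1 (by positivity)
      apply mul_pos (by positivity)
      linarith
    have hfin : 0 < δ * Real.exp (-α * ‖z - y'‖ ^ 2) *
        ∑ k, g k * (4 * α ^ 2 * (inner ℝ (z - y') (b k)) ^ 2 - 2 * α) := by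
      apply mul_pos (mul_pos hδ (Real.exp_pos _))
      linarith
    linarith
  have hsub : ({(0 : EuclideanSpace ℝ (Fin n))}ᶜ : Set (EuclideanSpace ℝ (Fin n))) ⊆ S := by
    apply hconn.subset_of_closure_inter_subset hSopen
    · obtain ⟨x, hx, hxM⟩ := hex
      exact ⟨x, hx, hx, hxM⟩
    · rintro x ⟨hxc, hx0⟩
      refine ⟨hx0, ?_⟩
      have hca : ContinuousAt V x := hcont.continuousAt (hopen0.mem_nhds hx0)
      by_contra hne
      have : ∀ᶠ z in nhds x, V z ≠ M := hca.eventually_ne hne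
      obtain ⟨z, hz1, hz2⟩ := ((mem_closure_iff_frequently.1 hxc).and_eventually this).exists
      exact hz2 hz1.2
  exact fun x hx => (hsub hx).2

lemma sl_line {E F : Type*} [NormedAddCommGroup E] [NormedSpace ℝ E] [NormedAddCommGroup F]
    [NormedSpace ℝ F] (f : E → F) (x v : E) (t : ℝ) (h : DifferentiableAt ℝ f (x + t • v)) :
    HasDerivAt (fun s : ℝ => f (x + s • v)) (fderiv ℝ f (x + t • v) v) t := by
  have h1 : HasDerivAt (fun s : ℝ => x + s • v) v t := by
    simpa using ((hasDerivAt_id t).smul_const v).const_add x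
  exact h.hasFDerivAt.comp_hasDerivAt t h1

lemma sl_eval {E F : Type*} [NormedAddCommGroup E] [NormedSpace ℝ E] [NormedAddCommGroup F]
    [NormedSpace ℝ F] {c : ℝ → E →L[ℝ] F} {c' : E →L[ℝ] F} {t : ℝ} (h : HasDerivAt c c' t) (a : E) :
    HasDerivAt (fun s => c s a) (c' a) t :=
  (h.clm_apply (hasDerivAt_const t a)).congr_deriv (by simp)

lemma sl_near {E : Type*} [NormedAddCommGroup E] [NormedSpace ℝ E] (x v : E) (hx : x ≠ 0) :
    ∀ᶠ t : ℝ in nhds 0, x + t • v ≠ 0 := by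
  have : ContinuousAt (fun t : ℝ => x + t • v) 0 := by fun_prop
  exact this.eventually_ne (by simpa using hx)

lemma sl_smooth {E F : Type*} [NormedAddCommGroup E] [NormedSpace ℝ E] [NormedAddCommGroup F]
    [NormedSpace ℝ F] {f : E → F} {x : E} (h : ContDiffAt ℝ (⊤ : ℕ∞) f x) :
    ContDiffAt ℝ (⊤ : ℕ∞) (fderiv ℝ f) x := h.fderiv_right (by simp)

lemma sl_symm2 {E F : Type*} [NormedAddCommGroup E] [NormedSpace ℝ E] [NormedAddCommGroup F]
    [NormedSpace ℝ F] {f : E → F} {x : E} (h : ContDiffAt ℝ (⊤ : ℕ∞) f x) (a b : E) :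
    fderiv ℝ (fderiv ℝ f) x a b = fderiv ℝ (fderiv ℝ f) x b a :=
  (h.isSymmSndFDerivAt (by simp; exact WithTop.coe_le_coe.2 le_top)) a b

lemma sl_symm3 {E F : Type*} [NormedAddCommGroup E] [NormedSpace ℝ E] [NormedAddCommGroup F]
    [NormedSpace ℝ F] {f : E → E →L[ℝ] E →L[ℝ] F} {x : E} (h : DifferentiableAt ℝ f x)
    (hx : x ≠ 0) (hs : ∀ y, y ≠ 0 → ∀ a b, f y a b = f y b a) (c a b : E) :
    fderiv ℝ f x c a b = fderiv ℝ f x c b a := by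
  have h' : DifferentiableAt ℝ f (x + (0:ℝ) • c) := by simpa using h
  have h1 := sl_eval (sl_eval (sl_line f x c 0 h') a) b
  have h2 := sl_eval (sl_eval (sl_line f x c 0 h') b) a
  have h3 : (fun s : ℝ => f (x + s • c) a b) =ᶠ[nhds 0] (fun s : ℝ => f (x + s • c) b a) := by
    filter_upwards [sl_near x c hx] with t ht
    exact hs _ ht a b
  have := (h1.congr_of_eventuallyEq h3.symm).unique h2
  simpa using this

lemma sl_symm4 {E F G : Type*} [NormedAddCommGroup E] [NormedSpace ℝ E] [NormedAddCommGroup F]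
    [NormedSpace ℝ F] [NormedAddCommGroup G] [NormedSpace ℝ G] {f : E → F} {x : E}
    (h : DifferentiableAt ℝ f x)
    (hx : x ≠ 0) (L1 L2 : F →L[ℝ] G) (hs : ∀ y, y ≠ 0 → L1 (f y) = L2 (f y)) (d : E) :
    L1 (fderiv ℝ f x d) = L2 (fderiv ℝ f x d) := by
  have h' : DifferentiableAt ℝ f (x + (0:ℝ) • d) := by simpa using h
  have h0 := sl_line f x d 0 h'
  have h1 := L1.hasFDerivAt.comp_hasDerivAt 0 h0
  have h2 := L2.hasFDerivAt.comp_hasDerivAt 0 h0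
  have h3 : (fun s : ℝ => L1 (f (x + s • d))) =ᶠ[nhds 0] (fun s : ℝ => L2 (f (x + s • d))) := by
    filter_upwards [sl_near x d hx] with t ht
    exact hs _ ht
  have := (h1.congr_of_eventuallyEq h3.symm).unique h2
  simpa using this

/-- The matrix `1 + i A` in a basis. -/
noncomputable def slMat {n : ℕ} (b : OrthonormalBasis (Fin n) ℝ (EuclideanSpace ℝ (Fin n)))
    (A : EuclideanSpace ℝ (Fin n) →L[ℝ] EuclideanSpace ℝ (Fin n) →L[ℝ] ℝ) :
    Matrix (Fin n) (Fin n) ℂ :=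
  Matrix.of fun i j => (1 : Matrix (Fin n) (Fin n) ℂ) i j + Complex.I * ((A (b i) (b j) : ℝ) : ℂ)

lemma sl_basis_change {n : ℕ} (b : OrthonormalBasis (Fin n) ℝ (EuclideanSpace ℝ (Fin n)))
    (A : EuclideanSpace ℝ (Fin n) →L[ℝ] EuclideanSpace ℝ (Fin n) →L[ℝ] ℝ) :
    (slMat b A).det = (slMat (EuclideanSpace.basisFun (Fin n) ℝ) A).det := by
  set Q : Matrix (Fin n) (Fin n) ℂ := Matrix.of fun i j => ((b j i : ℝ) : ℂ) with hQ
  have hQQ : Q.transpose * Q = 1 := by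
    ext i j
    have h := orthonormal_iff_ite.1 b.orthonormal i j
    rw [PiLp.inner_apply] at h
    simp only [RCLike.inner_apply, conj_trivial] at h
    simp only [Matrix.mul_apply, Matrix.transpose_apply, hQ, Matrix.of_apply, Matrix.one_apply]
    have h' := congrArg (fun r : ℝ => (r : ℂ)) h
    have h2 : (((if i = j then 1 else 0 : ℝ)) : ℂ) = if i = j then 1 else 0 := by
      split_ifs <;> simp
    rw [h2] at h'
    push_cast at h'
    rw [← h']
    refine Finset.sum_congr rfl fun k _ => ?_
    ring
  have hexp : ∀ j, b j = ∑ i, (b j i) • EuclideanSpace.basisFun (Fin n) ℝ i := by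
    intro j
    have := (EuclideanSpace.basisFun (Fin n) ℝ).sum_repr (b j)
    simpa using this.symm
  have key : slMat b A = Q.transpose * slMat (EuclideanSpace.basisFun (Fin n) ℝ) A * Q := by
    set B : Matrix (Fin n) (Fin n) ℂ := Matrix.of fun i j =>
      ((A (EuclideanSpace.basisFun (Fin n) ℝ i) (EuclideanSpace.basisFun (Fin n) ℝ j) : ℝ) : ℂ) with hB
    have e1 : slMat (EuclideanSpace.basisFun (Fin n) ℝ) A = 1 + Complex.I • B := by
      ext i j; simp [slMat, hB]
    rw [e1, Matrix.mul_add, Matrix.add_mul, Matrix.mul_one, hQQ]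
    ext i j
    simp only [slMat, Matrix.of_apply, Matrix.add_apply]
    congr 1
    rw [Matrix.mul_smul, Matrix.smul_mul, Matrix.smul_apply, smul_eq_mul]
    congr 1
    conv_lhs => rw [hexp i, hexp j]
    simp only [map_sum, map_smul, _root_.sum_apply, _root_.smul_apply,
      smul_eq_mul, Matrix.mul_apply, Matrix.transpose_apply, hQ, hB, Matrix.of_apply]
    push_cast
    refine Finset.sum_congr rfl fun k _ => ?_
    rw [Finset.sum_mul, Finset.mul_sum]
    refine Finset.sum_congr rfl fun l _ => ?_
    ring
  rw [key, Matrix.det_mul, Matrix.det_mul, mul_right_comm, ← Matrix.det_mul, hQQ]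
  simp

lemma sl_one_add (l : ℝ) : (1 + Complex.I * (l : ℂ)) =
    ((Real.sqrt (1 + l ^ 2) : ℝ) : ℂ) * Complex.exp (Complex.I * (Real.arctan l : ℝ)) := by
  have hp : 0 < Real.sqrt (1 + l ^ 2) := by positivity
  have hne : ((Real.sqrt (1 + l ^ 2) : ℝ) : ℂ) ≠ 0 := by exact_mod_cast hp.ne'
  rw [mul_comm Complex.I ((Real.arctan l : ℝ) : ℂ), Complex.exp_mul_I, ← Complex.ofReal_cos,
    ← Complex.ofReal_sin, Real.cos_arctan, Real.sin_arctan]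
  push_cast
  field_simp

/-- `exp(-ic) det(1 + i A)`. -/
noncomputable def slG {n : ℕ} (c : ℝ)
    (A : EuclideanSpace ℝ (Fin n) →L[ℝ] EuclideanSpace ℝ (Fin n) →L[ℝ] ℝ) : ℂ :=
  Complex.exp (-(Complex.I * c)) * (slMat (EuclideanSpace.basisFun (Fin n) ℝ) A).det

lemma sl_G_cont {n : ℕ} (c : ℝ) : Continuous (slG (n := n) c) := by
  unfold slG
  apply continuous_const.mul
  apply Continuous.matrix_det
  unfold slMat
  refine continuous_matrix fun i j => ?_
  simp only [Matrix.of_apply]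
  fun_prop

lemma sl_hess {n : ℕ} (u : EuclideanSpace ℝ (Fin n) → ℝ) (x : EuclideanSpace ℝ (Fin n)) (i j : Fin n) :
    Hess u x i j = fderiv ℝ (fderiv ℝ u) x (EuclideanSpace.single i 1) (EuclideanSpace.single j 1) := by
  simp [Hess, iteratedFDeriv_two_apply]

lemma sl_hess_eval {n : ℕ} (u : EuclideanSpace ℝ (Fin n) → ℝ) (x a b : EuclideanSpace ℝ (Fin n)) :
    fderiv ℝ (fderiv ℝ u) x a b = ∑ i, ∑ j, Hess u x i j * a i * b j := by
  have hexp : ∀ a : EuclideanSpace ℝ (Fin n), a = ∑ i, (a i) • EuclideanSpace.single i (1 : ℝ) := by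
    intro a
    have := (EuclideanSpace.basisFun (Fin n) ℝ).sum_repr a
    simpa using this.symm
  conv_lhs => rw [hexp a, hexp b]
  simp only [map_sum, map_smul, _root_.sum_apply, _root_.smul_apply,
    smul_eq_mul, sl_hess, Finset.mul_sum]
  rw [Finset.sum_comm]
  refine Finset.sum_congr rfl fun k _ => Finset.sum_congr rfl fun l _ => ?_
  ring

lemma sl_diag {n : ℕ} (u : EuclideanSpace ℝ (Fin n) → ℝ) (x : EuclideanSpace ℝ (Fin n))
    (h : (Hess u x).IsHermitian) (i j : Fin n) :
    fderiv ℝ (fderiv ℝ u) x (h.eigenvectorBasis i) (h.eigenvectorBasis j) =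
      if i = j then h.eigenvalues j else 0 := by
  rw [sl_hess_eval]
  have h1 := h.mulVec_eigenvectorBasis j
  have h2 : ∀ k, ∑ l, Hess u x k l * (h.eigenvectorBasis j) l =
      h.eigenvalues j * (h.eigenvectorBasis j) k := fun k => congrFun h1 k
  have h3 := orthonormal_iff_ite.1 h.eigenvectorBasis.orthonormal i j
  rw [PiLp.inner_apply] at h3
  simp only [RCLike.inner_apply, conj_trivial] at h3
  have : ∑ k, ∑ l, Hess u x k l * (h.eigenvectorBasis i) k * (h.eigenvectorBasis j) l =
      ∑ k, h.eigenvalues j * ((h.eigenvectorBasis j) k * (h.eigenvectorBasis i) k) := by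
    refine Finset.sum_congr rfl fun k _ => ?_
    rw [← mul_assoc, ← h2, Finset.sum_mul]
    refine Finset.sum_congr rfl fun l _ => ?_
    ring
  rw [this, ← Finset.mul_sum, h3]
  simp

lemma sl_mat_diag {n : ℕ} (u : EuclideanSpace ℝ (Fin n) → ℝ) (x : EuclideanSpace ℝ (Fin n))
    (h : (Hess u x).IsHermitian) :
    slMat h.eigenvectorBasis (fderiv ℝ (fderiv ℝ u) x) =
      Matrix.diagonal fun i => 1 + Complex.I * (h.eigenvalues i : ℂ) := by
  ext i j
  simp only [slMat, Matrix.of_apply, sl_diag, Matrix.diagonal_apply, Matrix.one_apply]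
  by_cases hij : i = j <;> simp [hij]

lemma sl_G_val {n : ℕ} (u : EuclideanSpace ℝ (Fin n) → ℝ) (c : ℝ) (x : EuclideanSpace ℝ (Fin n))
    (h : (Hess u x).IsHermitian) (hs : ∑ i, Real.arctan (h.eigenvalues i) = c) :
    slG c (fderiv ℝ (fderiv ℝ u) x) = ((∏ i, Real.sqrt (1 + h.eigenvalues i ^ 2) : ℝ) : ℂ) := by
  unfold slG
  rw [← sl_basis_change h.eigenvectorBasis, sl_mat_diag, Matrix.det_diagonal]
  simp only [sl_one_add]
  rw [Finset.prod_mul_distrib, ← Complex.exp_sum, ← Finset.mul_sum, ← Complex.ofReal_sum, hs]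
  rw [mul_left_comm, ← Complex.exp_add]
  simp

set_option maxSynthPendingDepth 3 in
lemma sl_symms {n : ℕ} (u : EuclideanSpace ℝ (Fin n) → ℝ)
    (hs : ∀ y, y ≠ 0 → ContDiffAt ℝ (⊤ : ℕ∞) u y) (x : EuclideanSpace ℝ (Fin n)) (hx : x ≠ 0) :
    (∀ a b c, fderiv ℝ (fderiv ℝ (fderiv ℝ u)) x a b c = fderiv ℝ (fderiv ℝ (fderiv ℝ u)) x b a c) ∧
    (∀ a b c, fderiv ℝ (fderiv ℝ (fderiv ℝ u)) x a b c = fderiv ℝ (fderiv ℝ (fderiv ℝ u)) x a c b) ∧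
    (∀ a b, fderiv ℝ (fderiv ℝ (fderiv ℝ (fderiv ℝ u))) x a a b b =
      fderiv ℝ (fderiv ℝ (fderiv ℝ (fderiv ℝ u))) x b b a a) := by
  have hd2 : ∀ y, y ≠ 0 → DifferentiableAt ℝ (fderiv ℝ (fderiv ℝ u)) y := fun y hy =>
    (sl_smooth (sl_smooth (hs y hy))).differentiableAt (by simp)
  have hd3 : ∀ y, y ≠ 0 → DifferentiableAt ℝ (fderiv ℝ (fderiv ℝ (fderiv ℝ u))) y := fun y hy =>
    (sl_smooth (sl_smooth (sl_smooth (hs y hy)))).differentiableAt (by simp)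
  have h3a : ∀ y, y ≠ 0 → ∀ a b c, fderiv ℝ (fderiv ℝ (fderiv ℝ u)) y a b c =
      fderiv ℝ (fderiv ℝ (fderiv ℝ u)) y b a c := fun y hy a b c => by
    rw [sl_symm2 (sl_smooth (hs y hy)) a b]
  have h3b : ∀ y, y ≠ 0 → ∀ a b c, fderiv ℝ (fderiv ℝ (fderiv ℝ u)) y a b c =
      fderiv ℝ (fderiv ℝ (fderiv ℝ u)) y a c b := fun y hy a b c =>
    sl_symm3 (hd2 y hy) hy (fun z hz a b => sl_symm2 (hs z hz) a b) a b c
  refine ⟨h3a x hx, h3b x hx, ?_⟩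
  have h4a : ∀ a b c d, fderiv ℝ (fderiv ℝ (fderiv ℝ (fderiv ℝ u))) x a b c d =
      fderiv ℝ (fderiv ℝ (fderiv ℝ (fderiv ℝ u))) x b a c d := fun a b c d => by
    rw [sl_symm2 (sl_smooth (sl_smooth (hs x hx))) a b]
  have hl : ∀ a b c d, HasDerivAt (fun s : ℝ => fderiv ℝ (fderiv ℝ (fderiv ℝ u)) (x + s • a) b c d)
      (fderiv ℝ (fderiv ℝ (fderiv ℝ (fderiv ℝ u))) x a b c d) 0 := by
    intro a b c d
    have h' : DifferentiableAt ℝ (fderiv ℝ (fderiv ℝ (fderiv ℝ u))) (x + (0:ℝ) • a) := by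
      simpa using hd3 x hx
    have := sl_eval (sl_eval (sl_eval (sl_line _ x a 0 h') b) c) d
    simpa using this
  have h4b : ∀ a b c d, fderiv ℝ (fderiv ℝ (fderiv ℝ (fderiv ℝ u))) x a b c d =
      fderiv ℝ (fderiv ℝ (fderiv ℝ (fderiv ℝ u))) x a c b d := fun a b c d => by
    refine ((hl a b c d).congr_of_eventuallyEq ?_).unique (hl a c b d)
    filter_upwards [sl_near x a hx] with t ht
    exact h3a _ ht _ _ _
  have h4c : ∀ a b c d, fderiv ℝ (fderiv ℝ (fderiv ℝ (fderiv ℝ u))) x a b c d =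
      fderiv ℝ (fderiv ℝ (fderiv ℝ (fderiv ℝ u))) x a b d c := fun a b c d => by
    refine ((hl a b c d).congr_of_eventuallyEq ?_).unique (hl a b d c)
    filter_upwards [sl_near x a hx] with t ht
    exact h3b _ ht _ _ _
  intro a b
  rw [h4b a a b b, h4a a b a b, h4c b a a b, h4b b a b a]

lemma sl_frac (l : ℝ) : Complex.I / (1 + Complex.I * (l : ℂ)) =
    ((1 / (1 + l ^ 2) : ℝ) : ℂ) * ((l : ℂ) + Complex.I) := by
  have h1 : (1 + Complex.I * (l : ℂ)) ≠ 0 := by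
    intro h
    have := congrArg Complex.re h
    simp at this
  have h2 : (1 + (l : ℂ) ^ 2) ≠ 0 := by
    have : (0:ℝ) < 1 + l ^ 2 := by positivity
    exact_mod_cast this.ne'
  push_cast
  rw [div_eq_iff h1]
  field_simp
  linear_combination (-(l : ℂ)^2 - 0) * Complex.I_sq * 0 + (- (l:ℂ)) * Complex.I_sq

set_option maxSynthPendingDepth 3 in
set_option maxHeartbeats 1000000 in
lemma sl_point {n : ℕ} (u : EuclideanSpace ℝ (Fin n) → ℝ) (c : ℝ)
    (hs : ∀ y, y ≠ 0 → ContDiffAt ℝ (⊤ : ℕ∞) u y)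
    (hreal : ∀ y, y ≠ 0 → (slG c (fderiv ℝ (fderiv ℝ u) y)).im = 0)
    (x : EuclideanSpace ℝ (Fin n)) (hx : x ≠ 0) (h : (Hess u x).IsHermitian)
    (hpos : 0 < (slG c (fderiv ℝ (fderiv ℝ u) x)).re)
    (hl : ∀ i j, 0 < 3 + h.eigenvalues i ^ 2 + 2 * h.eigenvalues i * h.eigenvalues j) :
    ∃ (f1 : Fin n → ℝ → ℝ) (f2 : Fin n → ℝ),
      (∀ k, ∀ᶠ t in nhds (0 : ℝ), HasDerivAt (fun t : ℝ =>
        (slG c (fderiv ℝ (fderiv ℝ u) (x + t • h.eigenvectorBasis k))).re) (f1 k t) t) ∧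
      (∀ k, HasDerivAt (f1 k) (f2 k) 0) ∧
      0 ≤ ∑ k, (1 / (1 + h.eigenvalues k ^ 2)) * f2 k ∧
      (∑ k, (1 / (1 + h.eigenvalues k ^ 2)) * f2 k = 0 →
        ∀ i j k, fderiv ℝ (fderiv ℝ (fderiv ℝ u)) x (h.eigenvectorBasis i)
          (h.eigenvectorBasis j) (h.eigenvectorBasis k) = 0) := by
  set b := h.eigenvectorBasis with hb
  set l := h.eigenvalues with hldef
  obtain ⟨hT1, hT2, hU⟩ := sl_symms u hs x hx
  have hd2 : ∀ y, y ≠ 0 → DifferentiableAt ℝ (fderiv ℝ (fderiv ℝ u)) y := fun y hy =>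
    (sl_smooth (sl_smooth (hs y hy))).differentiableAt (by simp)
  have hd3 : ∀ y, y ≠ 0 → DifferentiableAt ℝ (fderiv ℝ (fderiv ℝ (fderiv ℝ u))) y := fun y hy =>
    (sl_smooth (sl_smooth (sl_smooth (hs y hy)))).differentiableAt (by simp)
  set T : Fin n → Fin n → Fin n → ℝ := fun i j k =>
    fderiv ℝ (fderiv ℝ (fderiv ℝ u)) x (b i) (b j) (b k) with hT
  set U : Fin n → Fin n → ℝ := fun k j =>
    fderiv ℝ (fderiv ℝ (fderiv ℝ (fderiv ℝ u))) x (b k) (b k) (b j) (b j) with hUdef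
  set q : ℂ := Complex.exp (-(Complex.I * c)) with hq
  set v : ℝ := (slG c (fderiv ℝ (fderiv ℝ u) x)).re with hv
  set g : Fin n → ℝ := fun k => 1 / (1 + l k ^ 2) with hg
  have hgpos : ∀ k, 0 < g k := fun k => by simp only [hg]; positivity
  set d : Fin n → ℂ := fun i => 1 + Complex.I * (l i : ℂ) with hd
  have hdne : ∀ i, d i ≠ 0 := by
    intro i h
    have := congrArg Complex.re h
    simp [hd] at this
  set M : Fin n → ℝ → Matrix (Fin n) (Fin n) ℂ := fun k t =>
    slMat b (fderiv ℝ (fderiv ℝ u) (x + t • b k)) with hM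
  set M1 : Fin n → ℝ → Matrix (Fin n) (Fin n) ℂ := fun k t => Matrix.of fun i j =>
    Complex.I * ((fderiv ℝ (fderiv ℝ (fderiv ℝ u)) (x + t • b k) (b k) (b i) (b j) : ℝ) : ℂ) with hM1
  set M2 : Fin n → Matrix (Fin n) (Fin n) ℂ := fun k => Matrix.of fun i j =>
    Complex.I * ((fderiv ℝ (fderiv ℝ (fderiv ℝ (fderiv ℝ u))) x (b k) (b k) (b i) (b j) : ℝ) : ℂ)
    with hM2
  have hGM : ∀ k t, slG c (fderiv ℝ (fderiv ℝ u) (x + t • b k)) = q * (M k t).det := by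
    intro k t
    simp only [hM, slG]
    rw [sl_basis_change b]
  have hM0 : ∀ k, M k 0 = Matrix.diagonal d := by
    intro k
    simp only [hM, zero_smul, add_zero]
    exact sl_mat_diag u x h
  have hder : ∀ k, ∀ t : ℝ, x + t • b k ≠ 0 → ∀ i j,
      HasDerivAt (fun s => M k s i j) (M1 k t i j) t := by
    intro k t ht i j
    have h1 := sl_eval (sl_eval (sl_line _ x (b k) t (hd2 _ ht)) (b i)) (b j)
    have h2 := (h1.ofReal_comp.const_mul Complex.I).const_add ((1 : Matrix (Fin n) (Fin n) ℂ) i j)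
    exact h2
  have hder1 : ∀ k i j, HasDerivAt (fun s => M1 k s i j) (M2 k i j) 0 := by
    intro k i j
    have h' : DifferentiableAt ℝ (fderiv ℝ (fderiv ℝ (fderiv ℝ u))) (x + (0:ℝ) • b k) := by
      simpa using hd3 x hx
    have h1 := sl_eval (sl_eval (sl_eval (sl_line _ x (b k) 0 h') (b k)) (b i)) (b j)
    have h2 := (h1.ofReal_comp.const_mul Complex.I)
    refine h2.congr_deriv ?_
    simp only [zero_smul, add_zero, hM2, Matrix.of_apply]
  have hsec := fun k => sl_det_second (M k) (M1 k) (M2 k) d hdne (hM0 k)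
    (hder k 0 (by simpa using hx)) (hder1 k)
  set D1 : Fin n → ℝ → ℂ := fun k t => q * ((M k t).adjugate * M1 k t).trace with hD1
  have hdet : ∀ k, ∀ᶠ t in nhds (0:ℝ), HasDerivAt (fun s => q * (M k s).det) (D1 k t) t := by
    intro k
    filter_upwards [sl_near x (b k) hx] with t ht
    exact (sl_det_hasDerivAt (M k) (M1 k t) t (hder k t ht)).const_mul q
  have hqv : ∀ k, q * (M k 0).det = (v : ℂ) := by
    intro k
    rw [← hGM]
    apply Complex.ext
    · simp [hv]
    · simpa using hreal x hx
  set s1 : Fin n → ℂ := fun k => ∑ j, M1 k 0 j j / d j with hs1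
  set S : Fin n → ℂ := fun k => s1 k ^ 2 + ∑ j, M2 k j j / d j
        - ∑ i, ∑ j, M1 k 0 i j * M1 k 0 j i / (d i * d j) with hS
  have hD10 : ∀ k, D1 k 0 = v * s1 k := by
    intro k
    simp only [hD1]
    rw [(hsec k).1, ← mul_assoc, hqv]
  have hD2 : ∀ k, HasDerivAt (D1 k) (v * S k) 0 := by
    intro k
    refine ((hsec k).2.const_mul q).congr_deriv ?_
    rw [← mul_assoc, hqv]
  -- imaginary part vanishes
  have him0 : ∀ k, ∀ᶠ t in nhds (0:ℝ), (D1 k t).im = 0 := by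
    intro k
    have e : ∀ᶠ t in nhds (0:ℝ), (q * (M k t).det).im = 0 := by
      filter_upwards [sl_near x (b k) hx] with t ht
      rw [← hGM]; exact hreal _ ht
    filter_upwards [hdet k, e.eventually_nhds] with t ht het
    have h1 : HasDerivAt (fun s => (q * (M k s).det).im) ((D1 k t).im) t :=
      Complex.imCLM.hasFDerivAt.comp_hasDerivAt t ht
    have h2 : HasDerivAt (fun s => (q * (M k s).det).im) 0 t :=
      (hasDerivAt_const t (0:ℝ)).congr_of_eventuallyEq het
    exact h1.unique h2
  have hs1im : ∀ k, (s1 k).im = 0 := by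
    intro k
    have h1 := (him0 k).self_of_nhds
    rw [hD10, Complex.im_ofReal_mul] at h1
    exact (mul_eq_zero.1 h1).resolve_left hpos.ne'
  have hSim : ∀ k, (S k).im = 0 := by
    intro k
    have h1 : HasDerivAt (fun s => (D1 k s).im) ((v * S k).im) 0 :=
      Complex.imCLM.hasFDerivAt.comp_hasDerivAt 0 (hD2 k)
    have h2 : HasDerivAt (fun s => (D1 k s).im) 0 0 :=
      (hasDerivAt_const (0:ℝ) (0:ℝ)).congr_of_eventuallyEq (him0 k)
    have h3 := h1.unique h2
    rw [Complex.im_ofReal_mul] at h3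
    exact (mul_eq_zero.1 h3).resolve_left hpos.ne'
  have hfr : ∀ j, Complex.I / d j = (g j : ℂ) * ((l j : ℂ) + Complex.I) := fun j => sl_frac (l j)
  have hM10 : ∀ k i j, M1 k 0 i j = Complex.I * (T k i j : ℂ) := by
    intro k i j; simp only [hM1, Matrix.of_apply, zero_smul, add_zero, hT]
  have hM20 : ∀ k j, M2 k j j = Complex.I * (U k j : ℂ) := by
    intro k j; simp only [hM2, Matrix.of_apply, hUdef]
  have hSval : ∀ k, S k = s1 k ^ 2 + ∑ j, ((g j * U k j : ℝ) : ℂ) * ((l j : ℂ) + Complex.I)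
      + ∑ i, ∑ j, ((g i * g j * T k i j ^ 2 : ℝ) : ℂ) *
        (((1 - l i * l j : ℝ) : ℂ) - ((l i + l j : ℝ) : ℂ) * Complex.I) := by
    intro k
    simp only [hS]
    rw [sub_eq_add_neg, ← Finset.sum_neg_distrib]
    congr 1
    · congr 1
      refine Finset.sum_congr rfl fun j _ => ?_
      rw [hM20, mul_comm Complex.I, mul_div_assoc, hfr]
      push_cast; ring
    · refine Finset.sum_congr rfl fun i _ => ?_
      rw [← Finset.sum_neg_distrib]
      refine Finset.sum_congr rfl fun j _ => ?_
      rw [hM10, hM10]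
      have : T k j i = T k i j := hT2 _ _ _
      rw [this]
      have e : Complex.I * (T k i j : ℂ) * (Complex.I * (T k i j : ℂ)) / (d i * d j) =
          (T k i j : ℂ) ^ 2 * ((Complex.I / d i) * (Complex.I / d j)) := by
        field_simp [hdne i, hdne j]
      rw [e, hfr, hfr]
      push_cast
      linear_combination (-(T k i j : ℂ) ^ 2 * g i * g j) * Complex.I_sq
  have hre : ∀ k, (S k).re = (s1 k).re ^ 2 + ∑ j, g j * l j * U k j
      + ∑ i, ∑ j, g i * g j * (1 - l i * l j) * T k i j ^ 2 := by
    intro k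
    rw [hSval]
    simp only [Complex.add_re, Complex.re_sum, Complex.re_ofReal_mul, Complex.sub_re,
      Complex.ofReal_re, Complex.I_re, mul_zero, sub_zero, add_zero, pow_two (s1 k),
      Complex.mul_re (s1 k), hs1im]
    congr 1
    · congr 1
      · ring
      · refine Finset.sum_congr rfl fun j _ => ?_
        ring
    · refine Finset.sum_congr rfl fun i _ => Finset.sum_congr rfl fun j _ => ?_
      ring
  have him : ∀ k, ∑ j, g j * U k j = ∑ i, ∑ j, g i * g j * (l i + l j) * T k i j ^ 2 := by
    intro k
    have h1 := hSim k
    rw [hSval] at h1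
    simp only [Complex.add_im, Complex.im_sum, Complex.im_ofReal_mul, Complex.sub_im,
      Complex.ofReal_im, Complex.I_im, mul_zero, sub_zero, add_zero, zero_add, zero_sub, mul_one,
      pow_two (s1 k), Complex.mul_im (s1 k), hs1im, zero_mul] at h1
    have h2 : ∑ i, ∑ j, g i * g j * T k i j ^ 2 * -(l i + l j) =
        - ∑ i, ∑ j, g i * g j * (l i + l j) * T k i j ^ 2 := by
      rw [← Finset.sum_neg_distrib]
      refine Finset.sum_congr rfl fun i _ => ?_
      rw [← Finset.sum_neg_distrib]
      refine Finset.sum_congr rfl fun j _ => ?_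
      ring
    rw [h2] at h1
    linarith
  obtain ⟨hc1, hc2⟩ := sl_core l T U (fun i j => hU _ _) (fun i j k => hT1 _ _ _)
    (fun i j k => hT2 _ _ _) hl g hgpos him (fun k => (s1 k).re) (fun k => (S k).re) hre
  have hsum : ∑ k, (1 / (1 + l k ^ 2)) * (v * (S k).re) = v * ∑ k, g k * (S k).re := by
    rw [Finset.mul_sum]
    refine Finset.sum_congr rfl fun k _ => ?_
    simp only [hg]; ring
  refine ⟨fun k t => (D1 k t).re, fun k => v * (S k).re, ?_, ?_, ?_, ?_⟩
  · intro k
    filter_upwards [hdet k] with t ht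
    simp only [hGM]
    exact Complex.reCLM.hasFDerivAt.comp_hasDerivAt t ht
  · intro k
    have h1 : HasDerivAt (fun s => (D1 k s).re) ((v * S k).re) 0 :=
      Complex.reCLM.hasFDerivAt.comp_hasDerivAt 0 (hD2 k)
    rw [Complex.re_ofReal_mul] at h1
    exact h1
  · rw [hsum]
    exact mul_nonneg hpos.le hc1
  · intro h0
    rw [hsum] at h0
    exact hc2 ((mul_eq_zero.1 h0).resolve_left hpos.ne')

lemma sl_hom {E F : Type*} [NormedAddCommGroup E] [NormedSpace ℝ E] [NormedAddCommGroup F]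
    [NormedSpace ℝ F] (f : E → F) (t : ℝ) (ht : 0 < t) (k : ℕ)
    (hf : ∀ y, y ≠ 0 → f (t • y) = t ^ (k + 1) • f y) (y : E) (hy : y ≠ 0)
    (hd : DifferentiableAt ℝ f y) : fderiv ℝ f (t • y) = t ^ k • fderiv ℝ f y := by
  have h1 : fderiv ℝ (fun z => f (t • z)) y = t • fderiv ℝ f (t • y) := fderiv_comp_smul t
  have h2 : (fun z => f (t • z)) =ᶠ[nhds y] (fun z => t ^ (k + 1) • f z) := by
    filter_upwards [isOpen_compl_singleton.mem_nhds (show y ∈ ({0} : Set E)ᶜ from hy)] with z hz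
    exact hf z hz
  rw [h2.fderiv_eq, fderiv_fun_const_smul hd] at h1
  have h3 : t • fderiv ℝ f (t • y) = t • (t ^ k • fderiv ℝ f y) := by
    rw [← h1, smul_smul, pow_succ']
  exact smul_right_injective _ ht.ne' h3

set_option maxSynthPendingDepth 3 in
lemma sl_const {n : ℕ} (hn : 2 ≤ n) (u : EuclideanSpace ℝ (Fin n) → ℝ) (c : ℝ)
    (hs : ∀ y, y ≠ 0 → ContDiffAt ℝ (⊤ : ℕ∞) u y)
    (hhom0 : ∀ t : ℝ, 0 < t → ∀ y, y ≠ 0 →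
      fderiv ℝ (fderiv ℝ u) (t • y) = fderiv ℝ (fderiv ℝ u) y)
    (hsym : ∀ x : EuclideanSpace ℝ (Fin n), x ≠ 0 → (Hess u x).IsHermitian)
    (hsol : ∀ (x : EuclideanSpace ℝ (Fin n)) (hx : x ≠ 0),
      ∑ i, Real.arctan ((hsym x hx).eigenvalues i) = c)
    (hl : ∀ (x : EuclideanSpace ℝ (Fin n)) (hx : x ≠ 0), ∀ i j : Fin n,
      0 < 3 + ((hsym x hx).eigenvalues i) ^ 2 +
        2 * (hsym x hx).eigenvalues i * (hsym x hx).eigenvalues j) :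
    ∀ x, x ≠ 0 → ∀ y, y ≠ 0 → fderiv ℝ (fderiv ℝ u) x = fderiv ℝ (fderiv ℝ u) y := by
  have hconn : IsPreconnected ({(0 : EuclideanSpace ℝ (Fin n))}ᶜ : Set (EuclideanSpace ℝ (Fin n))) := by
    apply IsConnected.isPreconnected
    apply isConnected_compl_singleton_of_one_lt_rank
    rw [← Module.finrank_eq_rank]
    simp only [finrank_euclideanSpace, Fintype.card_fin]
    exact_mod_cast hn
  have hopen0 : IsOpen ({(0 : EuclideanSpace ℝ (Fin n))}ᶜ : Set (EuclideanSpace ℝ (Fin n))) :=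
    isOpen_compl_singleton
  have hU2 : ∀ y, y ≠ 0 → DifferentiableAt ℝ (fderiv ℝ (fderiv ℝ u)) y := fun y hy =>
    (sl_smooth (sl_smooth (hs y hy))).differentiableAt (by simp)
  have hreal : ∀ y, y ≠ 0 → (slG c (fderiv ℝ (fderiv ℝ u) y)).im = 0 := by
    intro y hy
    rw [sl_G_val u c y (hsym y hy) (hsol y hy), Complex.ofReal_im]
  set V : EuclideanSpace ℝ (Fin n) → ℝ := fun y => (slG c (fderiv ℝ (fderiv ℝ u) y)).re with hV
  have hVval : ∀ y (hy : y ≠ 0), V y = ∏ i, √(1 + (hsym y hy).eigenvalues i ^ 2) := by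
    intro y hy
    simp only [hV]
    rw [sl_G_val u c y (hsym y hy) (hsol y hy), Complex.ofReal_re]
  have hone : ∀ r : ℝ, 1 ≤ √(1 + r ^ 2) := fun r => Real.one_le_sqrt.2 (by nlinarith [sq_nonneg r])
  have hVge : ∀ y (hy : y ≠ 0) k, √(1 + (hsym y hy).eigenvalues k ^ 2) ≤ V y := by
    intro y hy k
    rw [hVval y hy, ← Finset.mul_prod_erase Finset.univ _ (Finset.mem_univ k)]
    have : (1:ℝ) ≤ ∏ i ∈ Finset.univ.erase k, √(1 + (hsym y hy).eigenvalues i ^ 2) :=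
      Finset.prod_induction _ (fun r : ℝ => 1 ≤ r)
        (fun a b ha hb => one_le_mul_of_one_le_of_one_le ha hb) le_rfl (fun i _ => hone _)
    exact le_mul_of_one_le_right (by positivity) this
  have hVpos : ∀ y, y ≠ 0 → 0 < V y := by
    intro y hy
    have h1 := hVge y hy ⟨0, by omega⟩
    have h2 := hone ((hsym y hy).eigenvalues ⟨0, by omega⟩)
    linarith
  have hcont : ContinuousOn V {0}ᶜ := by
    intro y hy
    apply ContinuousAt.continuousWithinAt
    exact Complex.continuous_re.continuousAt.comp
      ((sl_G_cont c).continuousAt.comp (hU2 y hy).continuousAt)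
  set e : EuclideanSpace ℝ (Fin n) := EuclideanSpace.single ⟨0, by omega⟩ 1 with he
  have he1 : ‖e‖ = 1 := by simp [he]
  have hsph : ∀ z ∈ Metric.sphere (0 : EuclideanSpace ℝ (Fin n)) 1, z ≠ 0 := by
    rintro z hz rfl
    simp at hz
  obtain ⟨z0, hz0, hmax⟩ := (isCompact_sphere (0 : EuclideanSpace ℝ (Fin n)) 1).exists_isMaxOn
    ⟨e, by simp [he1]⟩ (hcont.mono (fun z hz => hsph z hz))
  have hle : ∀ x, x ≠ 0 → V x ≤ V z0 := by
    intro x hx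
    have hx0 : 0 < ‖x‖ := norm_pos_iff.2 hx
    have h1 : V (‖x‖⁻¹ • x) = V x := by
      simp only [hV]
      rw [hhom0 _ (inv_pos.2 hx0) x hx]
    rw [← h1]
    apply hmax
    simp [norm_smul, hx0.ne']
  have hM := hVpos z0 (hsph z0 hz0)
  have hVM : ∀ x, x ≠ 0 → V x = V z0 := by
    refine sl_smp hn V (V z0) (1 / V z0 ^ 2) (by positivity) hcont hle ⟨z0, hsph z0 hz0, rfl⟩ ?_
    intro x hx
    obtain ⟨f1, f2, h1, h2, h3, -⟩ := sl_point u c hs hreal x hx (hsym x hx) (hVpos x hx) (hl x hx)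
    refine ⟨(hsym x hx).eigenvectorBasis, fun k => 1 / (1 + (hsym x hx).eigenvalues k ^ 2), f1, f2,
      ?_, h1, h2, h3⟩
    intro k
    have hp : 0 < 1 + (hsym x hx).eigenvalues k ^ 2 := by positivity
    constructor
    · apply one_div_le_one_div_of_le hp
      have := (hVge x hx k).trans (hle x hx)
      rwa [Real.sqrt_le_left hM.le] at this
    · rw [div_le_one hp]
      nlinarith [sq_nonneg ((hsym x hx).eigenvalues k)]
  have hU3 : ∀ x, x ≠ 0 → fderiv ℝ (fderiv ℝ (fderiv ℝ u)) x = 0 := by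
    intro x hx
    obtain ⟨f1, f2, h1, h2, -, h4⟩ := sl_point u c hs hreal x hx (hsym x hx) (hVpos x hx) (hl x hx)
    have hf1 : ∀ k, f1 k =ᶠ[nhds 0] fun _ => 0 := by
      intro k
      filter_upwards [h1 k, (sl_near x ((hsym x hx).eigenvectorBasis k) hx).eventually_nhds]
        with t ht hn'
      have : (fun _ : ℝ => V z0) =ᶠ[nhds t]
          (fun t => V (x + t • (hsym x hx).eigenvectorBasis k)) := by
        filter_upwards [hn'] with s hs'
        exact (hVM _ hs').symm
      exact (ht.congr_of_eventuallyEq this).unique (hasDerivAt_const t _)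
    have hf2 : ∀ k, f2 k = 0 := fun k =>
      ((h2 k).congr_of_eventuallyEq (hf1 k).symm).unique (hasDerivAt_const 0 _)
    have h5 := h4 (by simp [hf2])
    set b := (hsym x hx).eigenvectorBasis
    apply ContinuousLinearMap.coe_injective
    apply b.toBasis.ext
    intro i
    apply ContinuousLinearMap.coe_injective
    apply b.toBasis.ext
    intro j
    apply ContinuousLinearMap.coe_injective
    apply b.toBasis.ext
    intro k
    simpa using h5 i j k
  intro x hx y hy
  exact hopen0.is_const_of_fderiv_eq_zero hconn
    (fun z hz => (hU2 z hz).differentiableWithinAt) (fun z hz => hU3 z hz) hx hy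

/-- Homogeneous order-2 solutions away from the origin satisfying the
ε-convexity condition are quadratic (Lemma 2.3). -/
theorem stmt_10 {n : ℕ} (hn : 2 ≤ n) (u : EuclideanSpace ℝ (Fin n) → ℝ) (c : ℝ)
    (hu : ContDiffOn ℝ (⊤ : ℕ∞) u {(0 : EuclideanSpace ℝ (Fin n))}ᶜ)
    (hhom : ∀ x : EuclideanSpace ℝ (Fin n), x ≠ 0 → u x = ‖x‖ ^ 2 * u (‖x‖⁻¹ • x))
    (hsym : ∀ x : EuclideanSpace ℝ (Fin n), x ≠ 0 → (Hess u x).IsHermitian)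
    (hsol : ∀ (x : EuclideanSpace ℝ (Fin n)) (hx : x ≠ 0),
      ∑ i, Real.arctan ((hsym x hx).eigenvalues i) = c)
    (ε : ℝ) (hε : 0 < ε)
    (hcond : ∀ (x : EuclideanSpace ℝ (Fin n)) (hx : x ≠ 0), ∀ i j : Fin n,
      0 ≤ 3 + (1 - ε) * ((hsym x hx).eigenvalues i) ^ 2 +
        2 * (hsym x hx).eigenvalues i * (hsym x hx).eigenvalues j) :
    ∃ A : Matrix (Fin n) (Fin n) ℝ, A.IsSymm ∧
      (∀ x : EuclideanSpace ℝ (Fin n), x ≠ 0 → Hess u x = A) ∧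
      ∀ x : EuclideanSpace ℝ (Fin n), x ≠ 0 →
        u x = (1 / 2) * ∑ i, ∑ j, A i j * x i * x j := by
  have hs : ∀ y, y ≠ 0 → ContDiffAt ℝ (⊤ : ℕ∞) u y := fun y hy =>
    hu.contDiffAt (isOpen_compl_singleton.mem_nhds hy)
  have hh0 : ∀ t : ℝ, 0 < t → ∀ y, y ≠ 0 → u (t • y) = t ^ 2 • u y := by
    intro t ht y hy
    have h1 : ‖t • y‖⁻¹ • (t • y) = ‖y‖⁻¹ • y := by
      rw [norm_smul, smul_smul, Real.norm_of_nonneg ht.le]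
      congr 1
      field_simp
    rw [hhom (t • y) (smul_ne_zero ht.ne' hy), h1, hhom y hy, norm_smul,
      Real.norm_of_nonneg ht.le, smul_eq_mul]
    have h2 : ‖(‖y‖⁻¹ • y)‖ = 1 := by
      rw [norm_smul, norm_inv, norm_norm, inv_mul_cancel₀ (norm_ne_zero_iff.2 hy)]
    ring
  have hh1 : ∀ t : ℝ, 0 < t → ∀ y, y ≠ 0 → fderiv ℝ u (t • y) = t ^ 1 • fderiv ℝ u y :=
    fun t ht y hy => sl_hom u t ht 1 (hh0 t ht) y hy ((hs y hy).differentiableAt (by simp))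
  have hh2 : ∀ t : ℝ, 0 < t → ∀ y, y ≠ 0 →
      fderiv ℝ (fderiv ℝ u) (t • y) = fderiv ℝ (fderiv ℝ u) y := by
    intro t ht y hy
    have := sl_hom (fderiv ℝ u) t ht 0 (hh1 t ht) y hy
      ((sl_smooth (hs y hy)).differentiableAt (by simp))
    simpa using this
  have hl : ∀ (x : EuclideanSpace ℝ (Fin n)) (hx : x ≠ 0), ∀ i j : Fin n,
      0 < 3 + ((hsym x hx).eigenvalues i) ^ 2 +
        2 * (hsym x hx).eigenvalues i * (hsym x hx).eigenvalues j := by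
    intro x hx i j
    have h1 := hcond x hx i j
    by_cases h0 : (hsym x hx).eigenvalues i = 0
    · rw [h0]
      norm_num
    · have : 0 < ε * (hsym x hx).eigenvalues i ^ 2 := by positivity
      nlinarith
  have hconst := sl_const hn u c hs hh2 hsym hsol hl
  have he0 : (EuclideanSpace.single (⟨0, by omega⟩ : Fin n) (1 : ℝ)) ≠ 0 := by simp
  set e : EuclideanSpace ℝ (Fin n) := EuclideanSpace.single (⟨0, by omega⟩ : Fin n) (1 : ℝ) with he
  have hA : ∀ x : EuclideanSpace ℝ (Fin n), x ≠ 0 → Hess u x = Hess u e := by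
    intro x hx
    ext i j
    rw [sl_hess, sl_hess, hconst x hx e he0]
  refine ⟨Hess u e, ?_, hA, ?_⟩
  · have := hsym e he0
    rwa [Matrix.IsHermitian, Matrix.conjTranspose_eq_transpose_of_trivial] at this
  · intro x hx
    rw [← hA x hx, ← sl_hess_eval]
    have hx1 : x + (0 : ℝ) • x = x := by simp
    have hpos : ∀ᶠ t : ℝ in nhds 0, 0 < 1 + t := by
      have : ContinuousAt (fun t : ℝ => 1 + t) 0 := by fun_prop
      exact this.eventually_const_lt (by norm_num)
    have hsm : ∀ t : ℝ, x + t • x = (1 + t) • x := fun t => by rw [add_smul, one_smul]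
    have hd : HasDerivAt (fun t : ℝ => 1 + t) 1 0 := (hasDerivAt_id (0 : ℝ)).const_add 1
    have h1 := sl_line u x x 0 (by rw [hx1]; exact (hs x hx).differentiableAt (by simp))
    have h1e : (fun t : ℝ => (1 + t) ^ 2 * u x) =ᶠ[nhds 0] fun t => u (x + t • x) := by
      filter_upwards [hpos] with t ht
      rw [hsm, hh0 _ ht x hx, smul_eq_mul]
    have h1' := (h1.congr_of_eventuallyEq h1e).unique ((hd.pow 2).mul_const (u x))
    have h2 := sl_eval (sl_line (fderiv ℝ u) x x 0
      (by rw [hx1]; exact (sl_smooth (hs x hx)).differentiableAt (by simp))) x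
    have h2e : (fun t : ℝ => (1 + t) * fderiv ℝ u x x) =ᶠ[nhds 0]
        fun t => fderiv ℝ u (x + t • x) x := by
      filter_upwards [hpos] with t ht
      rw [hsm, hh1 _ ht x hx]
      simp
    have h2' := (h2.congr_of_eventuallyEq h2e).unique (hd.mul_const (fderiv ℝ u x x))
    rw [hx1] at h1' h2'
    norm_num at h1' h2'
    rw [h2', h1']
    ring
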